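/- Let k be a commutative ring, P̂ a finite poset with top element 1̂, and q ∈ P̂ with q < 1̂. Then for every i ≥ 0 there is an isomorphism Tor_i^{P̂}(S_{1̂}, S_q) ≅ H̃_{i−2}(Δ(q,1̂); k), where Δ(q,1̂) is the order complex of the open interval (q,1̂) = {p : q < p < 1̂}, i.e. the abstract simplicial complex whose faces are the finite chains in (q,1̂), and H̃ denotes reduced simplicial homology with coefficients in k (with the conventions that for the empty complex H̃_{−1} = k and all other reduced homology of the empty complex vanishes). -/

import Mathlib

/-!
STATEMENT 8: Let k be a commutative ring, P̂ a finite poset with top element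
1̂, and q < 1̂.  Then for every i ≥ 0 there is an isomorphism
Tor_i^{P̂}(S_{1̂}, S_q) ≅ H̃_{i−2}(Δ(q,1̂); k), where Δ(q,1̂) is the order
complex of the open interval (q,1̂) and H̃ is reduced simplicial homology with
coefficients in k (with H̃_{−2} = 0, and H̃_{−1} = k for the empty complex).

Tor is computed from an arbitrary free resolution of S_{1̂} (the statement is
for every such resolution); the order complex chain complex is built from
scratch from strictly increasing tuples in the open interval.
-/

open scoped DirectSum

noncomputable section

namespace PosetRep

variable (k : Type) [CommRing k] (P : Type) [PartialOrder P]

/-- A representation of a poset `P` (viewed as a category with a unique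
morphism `p → q` whenever `p ≤ q`) in `k`-modules. -/
structure PRep where
  M : P → Type
  [acg : ∀ p, AddCommGroup (M p)]
  [mod : ∀ p, Module k (M p)]
  map : ∀ {p q : P}, p ≤ q → (M p →ₗ[k] M q)
  map_refl : ∀ (p : P) (x : M p), map (le_refl p) x = x
  map_trans : ∀ {p q r : P} (hpq : p ≤ q) (hqr : q ≤ r) (x : M p),
    map hqr (map hpq x) = map (hpq.trans hqr) x

/-- A representation of the opposite poset `P^op` in `k`-modules. -/
structure PRepOp where
  M : P → Type
  [acg : ∀ p, AddCommGroup (M p)]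
  [mod : ∀ p, Module k (M p)]
  map : ∀ {p q : P}, p ≤ q → (M q →ₗ[k] M p)
  map_refl : ∀ (p : P) (x : M p), map (le_refl p) x = x
  map_trans : ∀ {p q r : P} (hpq : p ≤ q) (hqr : q ≤ r) (x : M r),
    map hpq (map hqr x) = map (hpq.trans hqr) x

attribute [instance] PRep.acg PRep.mod PRepOp.acg PRepOp.mod

variable {k P}

/-- Morphisms of `P`-representations. -/
structure RepHom (A B : PRep k P) where
  f : ∀ p, A.M p →ₗ[k] B.M p
  comm : ∀ {p q : P} (h : p ≤ q) (x : A.M p), f q (A.map h x) = B.map h (f p x)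

/-- Morphisms of `P^op`-representations. -/
structure RepOpHom (A B : PRepOp k P) where
  f : ∀ p, A.M p →ₗ[k] B.M p
  comm : ∀ {p q : P} (h : p ≤ q) (x : A.M q), f p (A.map h x) = B.map h (f q x)

variable (k P)

/-- The free `P^op`-module on a basis `B` with degrees `deg : B → P`; its value
at `p` is the free module on `{b : B // p ≤ deg b}`.  (`kP̂(−, q)` is the case
of a single basis element of degree `q`.) -/
def FreeOp (B : Type) (deg : B → P) : PRepOp k P where
  M p := {b : B // p ≤ deg b} →₀ k
  map {p q} h := Finsupp.lmapDomain k k (fun b => ⟨b.1, h.trans b.2⟩)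
  map_refl p x := by
    show Finsupp.mapDomain _ x = x
    have : (fun b : {b : B // p ≤ deg b} => (⟨b.1, (le_refl p).trans b.2⟩ :
        {b : B // p ≤ deg b})) = id := by
      funext b; rfl
    rw [this, Finsupp.mapDomain_id]
  map_trans {p q r} hpq hqr x := by
    show Finsupp.mapDomain _ (Finsupp.mapDomain _ x) = Finsupp.mapDomain _ x
    rw [← Finsupp.mapDomain_comp]
    rfl

/-- The canonical generator of the free module at a basis element. -/
def genOp (B : Type) (deg : B → P) (b : B) : (FreeOp k P B deg).M (deg b) :=
  Finsupp.single ⟨b, le_refl _⟩ 1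

/-- The submodule of `V` which is everything if `p = q` and `0` otherwise. -/
def diagSubmodule (p q : P) (V : Type) [AddCommGroup V] [Module k V] :
    Submodule k V where
  carrier := {v : V | p ≠ q → v = 0}
  zero_mem' := fun _ => rfl
  add_mem' := by
    intro a b ha hb
    intro h
    rw [ha h, hb h, add_zero]
  smul_mem' := by
    intro c v hv
    intro h
    simp only [Set.mem_setOf_eq] at hv ⊢
    rw [hv h, smul_zero]

open Classical in
/-- The "simple" `P^op`-representation `S_q ⊗ V`: the value is `V` at `q` and
`0` elsewhere, with all structure maps zero (except the identity at `q`). -/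
def SimpleOp (q : P) (V : Type) [AddCommGroup V] [Module k V] : PRepOp k P where
  M p := ↥(diagSubmodule k P p q V)
  map {p p'} _ :=
    { toFun := fun x => ⟨if p = p' then (x : V) else 0, by
        intro hpq
        by_cases hpp' : p = p'
        · simp only [hpp', if_true]
          exact x.2 (hpp' ▸ hpq)
        · simp [hpp']⟩
      map_add' := by
        intro x y
        apply Subtype.ext
        by_cases hpp' : p = p' <;> simp [hpp']
      map_smul' := by
        intro c x
        apply Subtype.ext
        by_cases hpp' : p = p' <;> simp [hpp'] }
  map_refl p x := by
    apply Subtype.ext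
    simp
  map_trans {p q' r} hpq hqr x := by
    apply Subtype.ext
    by_cases hpr : p = r
    · have hq' : p = q' := le_antisymm hpq (hpr ▸ hqr)
      have hq'r : q' = r := hq' ▸ hpr
      simp [hpr, hq', hq'r]
    · by_cases hpq' : p = q'
      · have : ¬ q' = r := fun h => hpr (hpq'.trans h)
        simp [hpq', hpr, this]
      · simp [hpq', hpr]

open Classical in
/-- The "simple" `P`-representation `S_q ⊗ V` (covariant version). -/
def Simple (q : P) (V : Type) [AddCommGroup V] [Module k V] : PRep k P where
  M p := ↥(diagSubmodule k P p q V)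
  map {p p'} _ :=
    { toFun := fun x => ⟨if p = p' then (x : V) else 0, by
        intro hpq
        by_cases hpp' : p = p'
        · simp only [hpp', if_true]
          exact x.2 (fun h => hpq (hpp' ▸ h))
        · simp [hpp']⟩
      map_add' := by
        intro x y
        apply Subtype.ext
        by_cases hpp' : p = p' <;> simp [hpp']
      map_smul' := by
        intro c x
        apply Subtype.ext
        by_cases hpp' : p = p' <;> simp [hpp'] }
  map_refl p x := by
    apply Subtype.ext
    simp
  map_trans {p q' r} hpq hqr x := by
    apply Subtype.ext
    by_cases hpr : p = r
    · have hq' : p = q' := le_antisymm hpq (hpr ▸ hqr)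
      have hq'r : q' = r := hq' ▸ hpr
      simp [hpr, hq', hq'r]
    · by_cases hpq' : p = q'
      · have : ¬ q' = r := fun h => hpr (hpq'.trans h)
        simp [hpq', hpr, this]
      · simp [hpq', hpr]

/-- A free resolution `⋯ → F₁ → F₀ → A → 0` of a `P^op`-representation `A` by
free modules, given by bases `B t` and degree functions `deg t`. -/
structure FreeRes (A : PRepOp k P) where
  B : ℕ → Type
  deg : ∀ t, B t → P
  d : ∀ t, RepOpHom (FreeOp k P (B (t + 1)) (deg (t + 1))) (FreeOp k P (B t) (deg t))
  aug : RepOpHom (FreeOp k P (B 0) (deg 0)) A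
  aug_surj : ∀ p, Function.Surjective ((aug.f) p)
  aug_d : ∀ p x, aug.f p ((d 0).f p x) = 0
  dd : ∀ t p x, (d t).f p ((d (t + 1)).f p x) = 0
  exact_aug : ∀ p x, aug.f p x = 0 → ∃ y, (d 0).f p y = x
  exact_d : ∀ t p x, (d t).f p x = 0 → ∃ y, (d (t + 1)).f p y = x

variable {k P}

/-- The tensor product over `P̂` of a free `P^op`-module with a
`P`-representation `N` is the direct sum `⨁_b N_{deg b}`. -/
abbrev tensorObj (B : Type) (deg : B → P) (N : PRep k P) : Type :=
  ⨁ b : B, N.M (deg b)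

/-- The map `F ⊗_P̂ N → F' ⊗_P̂ N` induced by a morphism of free
`P^op`-modules. -/
def tensorMap {B B' : Type} {deg : B → P} {deg' : B' → P}
    (φ : RepOpHom (FreeOp k P B deg) (FreeOp k P B' deg')) (N : PRep k P) :
    tensorObj B deg N →ₗ[k] tensorObj B' deg' N :=
  letI := Classical.decEq B
  letI := Classical.decEq B'
  DirectSum.toModule k B _ fun b =>
    Finsupp.sum (φ.f (deg b) (genOp k P B deg b))
      (fun i c => c • ((DirectSum.lof k B' (fun b' => N.M (deg' b')) i.1).comp
        (N.map i.2)))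

/-- Homology of a pair of composable linear maps. -/
abbrev homologyAt {A B C : Type} [AddCommGroup A] [Module k A] [AddCommGroup B]
    [Module k B] [AddCommGroup C] [Module k C]
    (dp : A →ₗ[k] B) (d : B →ₗ[k] C) : Type :=
  ↥(LinearMap.ker d) ⧸
    Submodule.comap (LinearMap.ker d).subtype (LinearMap.range dp)

/-- `Tor_i^{P̂}(A, N)`, computed from a chosen free resolution of `A`. -/
def Tor {A : PRepOp k P} (R : FreeRes k P A) (N : PRep k P) : ℕ → Type
  | 0 => (tensorObj (R.B 0) (R.deg 0) N) ⧸ LinearMap.range (tensorMap (R.d 0) N)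
  | (i + 1) => homologyAt (tensorMap (R.d (i + 1)) N) (tensorMap (R.d i) N)

instance {A : PRepOp k P} (R : FreeRes k P A) (N : PRep k P) (i : ℕ) :
    AddCommGroup (Tor R N i) := by
  cases i with
  | zero => exact inferInstanceAs (AddCommGroup ((tensorObj (R.B 0) (R.deg 0) N) ⧸
      LinearMap.range (tensorMap (R.d 0) N)))
  | succ i => exact inferInstanceAs (AddCommGroup
      (homologyAt (tensorMap (R.d (i + 1)) N) (tensorMap (R.d i) N)))

instance {A : PRepOp k P} (R : FreeRes k P A) (N : PRep k P) (i : ℕ) :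
    Module k (Tor R N i) := by
  cases i with
  | zero => exact inferInstanceAs (Module k ((tensorObj (R.B 0) (R.deg 0) N) ⧸
      LinearMap.range (tensorMap (R.d 0) N)))
  | succ i => exact inferInstanceAs (Module k
      (homologyAt (tensorMap (R.d (i + 1)) N) (tensorMap (R.d i) N)))

/-! ### Unbundled ℤ-indexed cochain complexes of `k`-modules -/

variable (k)

/-- An (unbundled) ℤ-indexed family of modules with maps of degree one.  The
condition `d² = 0` is not part of the data. -/
structure ZComplex where
  X : ℤ → Type
  [acg : ∀ m, AddCommGroup (X m)]
  [mod : ∀ m, Module k (X m)]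
  d : ∀ m, X m →ₗ[k] X (m + 1)

attribute [instance] ZComplex.acg ZComplex.mod

variable {k}

/-- `d² = 0`. -/
def ZComplex.IsComplex (C : ZComplex k) : Prop :=
  ∀ (m : ℤ) (x : C.X m), C.d (m + 1) (C.d m x) = 0

/-- Exactness at the spot `m+1`. -/
def ZComplex.ExactAt (C : ZComplex k) (m : ℤ) : Prop :=
  ∀ x : C.X (m + 1), C.d (m + 1) x = 0 → ∃ y : C.X m, C.d m y = x

/-- Exactness everywhere. -/
def ZComplex.Exact (C : ZComplex k) : Prop :=
  ∀ m : ℤ, C.ExactAt m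

/-- The mapping cone of a (raw) family of maps between complexes.  (It is the
honest mapping cone when the family is a chain map.) -/
def mapConeRaw {C D : ZComplex k} (f : ∀ m, C.X m →ₗ[k] D.X m) : ZComplex k where
  X m := C.X (m + 1) × D.X m
  d m := LinearMap.prod
    (-((C.d (m + 1)).comp (LinearMap.fst k (C.X (m + 1)) (D.X m))))
    ((f (m + 1)).comp (LinearMap.fst k (C.X (m + 1)) (D.X m)) +
      (D.d m).comp (LinearMap.snd k (C.X (m + 1)) (D.X m)))

/-- A family of maps is a quasi-isomorphism when its mapping cone is exact. -/
def IsQuasiIsoRaw {C D : ZComplex k} (f : ∀ m, C.X m →ₗ[k] D.X m) : Prop :=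
  ZComplex.Exact (mapConeRaw f)

/-- A chain map between raw complexes. -/
def IsChainMap {C D : ZComplex k} (f : ∀ m, C.X m →ₗ[k] D.X m) : Prop :=
  ∀ (m : ℤ) (x : C.X m), f (m + 1) (C.d m x) = D.d m (f m x)

end PosetRep

namespace PosetRep

variable (k : Type) [CommRing k] (P : Type) [PartialOrder P] [OrderTop P]

/-- `j`-simplices of the order complex of the open interval `(q, 1̂)`:
strictly increasing `(j+1)`-tuples of elements strictly between `q` and `1̂`. -/
def IntervalIdx (q : P) (j : ℕ) : Type :=
  {c : Fin (j + 1) → P // StrictMono c ∧ ∀ a : Fin (j + 1), q < c a ∧ c a < ⊤}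

/-- The module of simplicial `j`-chains of the order complex of `(q,1̂)`. -/
def chainMod (q : P) (j : ℕ) : Type := IntervalIdx P q j →₀ k

instance (q : P) (j : ℕ) : AddCommGroup (chainMod k P q j) :=
  inferInstanceAs (AddCommGroup (IntervalIdx P q j →₀ k))

instance (q : P) (j : ℕ) : Module k (chainMod k P q j) :=
  inferInstanceAs (Module k (IntervalIdx P q j →₀ k))

/-- The face of a simplex obtained by deleting the `r`-th vertex. -/
def intFace {P : Type} [PartialOrder P] [OrderTop P] {q : P} {j : ℕ}
    (r : Fin (j + 2)) (c : IntervalIdx P q (j + 1)) : IntervalIdx P q j :=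
  ⟨c.1 ∘ Fin.succAbove r,
    ⟨c.2.1.comp (Fin.strictMono_succAbove r), fun a => c.2.2 _⟩⟩

/-- The simplicial boundary map of the order complex. -/
def bdry (q : P) (j : ℕ) : chainMod k P q (j + 1) →ₗ[k] chainMod k P q j :=
  Finsupp.lift (chainMod k P q j) k (IntervalIdx P q (j + 1))
    (fun c => ∑ r : Fin (j + 2), ((-1 : k) ^ (r : ℕ)) •
      Finsupp.single (intFace r c) (1 : k))

/-- The augmentation of the simplicial chain complex. -/
def chainAug (q : P) : chainMod k P q 0 →ₗ[k] k :=
  Finsupp.lift k k (IntervalIdx P q 0) (fun _ => (1 : k))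

/-- Reduced simplicial homology of the order complex of `(q,1̂)`, reindexed:
`redH i = H̃_{i-2}` (so `redH 0 = H̃_{-2} = 0`, `redH 1 = H̃_{-1}`, and for the
empty complex `H̃_{-1} = k`). -/
def redH (q : P) : ℕ → Type
  | 0 => PUnit
  | 1 => k ⧸ LinearMap.range (chainAug k P q)
  | 2 => homologyAt (bdry k P q 0) (chainAug k P q)
  | (j + 3) => homologyAt (bdry k P q (j + 1)) (bdry k P q j)

instance (q : P) (i : ℕ) : AddCommGroup (redH k P q i) :=
  match i with
  | 0 => inferInstanceAs (AddCommGroup PUnit)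
  | 1 => inferInstanceAs (AddCommGroup (k ⧸ LinearMap.range (chainAug k P q)))
  | 2 => inferInstanceAs (AddCommGroup (homologyAt (bdry k P q 0) (chainAug k P q)))
  | (j + 3) => inferInstanceAs (AddCommGroup (homologyAt (bdry k P q (j + 1)) (bdry k P q j)))

instance (q : P) (i : ℕ) : Module k (redH k P q i) :=
  match i with
  | 0 => inferInstanceAs (Module k PUnit)
  | 1 => inferInstanceAs (Module k (k ⧸ LinearMap.range (chainAug k P q)))
  | 2 => inferInstanceAs (Module k (homologyAt (bdry k P q 0) (chainAug k P q)))
  | (j + 3) => inferInstanceAs (Module k (homologyAt (bdry k P q (j + 1)) (bdry k P q j)))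

end PosetRep

open PosetRep

namespace PosetRep

section Free

variable {k : Type} [CommRing k] {P : Type} [PartialOrder P] {B : Type} {deg : B → P}

/-- The basis element of the free module `FreeOp k P B deg` at `p` given by `b`. -/
def basisOp (b : B) {p : P} (h : p ≤ deg b) : (FreeOp k P B deg).M p :=
  Finsupp.single ⟨b, h⟩ 1

/-- The linear map out of a value of a free module determined by the images of the basis. -/
def liftOp {p : P} {V : Type} [AddCommGroup V] [Module k V] (x : ∀ b, p ≤ deg b → V) :
    (FreeOp k P B deg).M p →ₗ[k] V :=
  Finsupp.lift V k {b : B // p ≤ deg b} fun b => x b.1 b.2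

@[simp]
theorem liftOp_basisOp {p : P} {V : Type} [AddCommGroup V] [Module k V]
    (x : ∀ b, p ≤ deg b → V) (b : B) (h : p ≤ deg b) :
    liftOp x (basisOp (k := k) b h) = x b h := by
  unfold liftOp basisOp
  erw [Finsupp.lift_apply, Finsupp.sum_single_index] <;> simp

theorem freeOp_ext {p : P} {V : Type} [AddCommGroup V] [Module k V]
    {f g : (FreeOp k P B deg).M p →ₗ[k] V}
    (h : ∀ b (hb : p ≤ deg b), f (basisOp b hb) = g (basisOp b hb)) : f = g :=
  Finsupp.lhom_ext' (φ := f) (ψ := g) fun b => LinearMap.ext_ring (h b.1 b.2)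

@[simp]
theorem map_basisOp {p q : P} (hpq : p ≤ q) (b : B) (h : q ≤ deg b) :
    (FreeOp k P B deg).map hpq (basisOp b h) = basisOp b (hpq.trans h) :=
  Finsupp.mapDomain_single

/-- The morphism out of a free module determined by the images of the generators. -/
def homOfGen (X : PRepOp k P) (x : ∀ b, X.M (deg b)) : RepOpHom (FreeOp k P B deg) X where
  f p := liftOp fun b h => X.map h (x b)
  comm {p q} h y := by
    refine LinearMap.congr_fun
      (f := (liftOp fun b h => X.map h (x b)).comp ((FreeOp k P B deg).map h))
      (g := (X.map h).comp (liftOp fun b h => X.map h (x b))) (freeOp_ext fun b hb => ?_) y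
    simp [X.map_trans]

@[simp]
theorem homOfGen_basisOp (X : PRepOp k P) (x : ∀ b, X.M (deg b)) {p : P} (b : B)
    (h : p ≤ deg b) : (homOfGen X x).f p (basisOp b h) = X.map h (x b) :=
  liftOp_basisOp _ _ _

theorem RepOpHom.apply_basisOp {X : PRepOp k P} (φ : RepOpHom (FreeOp k P B deg) X) {p : P}
    (b : B) (h : p ≤ deg b) :
    φ.f p (basisOp b h) = X.map h (φ.f (deg b) (basisOp b le_rfl)) := by
  rw [← φ.comm, map_basisOp]

/-- Free modules are projective. -/
theorem exists_lift {X Y : PRepOp k P} (φ : RepOpHom (FreeOp k P B deg) Y) (ψ : RepOpHom X Y)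
    (h : ∀ p x, ∃ y, ψ.f p y = φ.f p x) :
    ∃ θ : RepOpHom (FreeOp k P B deg) X, ∀ p x, ψ.f p (θ.f p x) = φ.f p x := by
  choose y hy using h
  refine ⟨homOfGen X fun b => y (deg b) (basisOp b le_rfl), fun p => LinearMap.congr_fun
    (f := (ψ.f p).comp ((homOfGen X _).f p)) (freeOp_ext fun b hb => ?_)⟩
  simp [ψ.comm, hy, φ.apply_basisOp b hb]

/-- Composition of morphisms of `P^op`-representations. -/
def RepOpHom.comp {X Y Z : PRepOp k P} (φ : RepOpHom Y Z) (ψ : RepOpHom X Y) : RepOpHom X Z where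
  f p := (φ.f p).comp (ψ.f p)
  comm h x := by simp [ψ.comm, φ.comm]

/-- Difference of morphisms of `P^op`-representations. -/
def RepOpHom.sub {X Y : PRepOp k P} (φ ψ : RepOpHom X Y) : RepOpHom X Y where
  f p := φ.f p - ψ.f p
  comm h x := by simp [ψ.comm, φ.comm]

/-- The identity morphism of a `P^op`-representation. -/
def RepOpHom.id (X : PRepOp k P) : RepOpHom X X where
  f _ := LinearMap.id
  comm _ _ := rfl

end Free

section Tensor

variable {k : Type} [CommRing k] {P : Type} [PartialOrder P] {B B' : Type} {deg : B → P}
  {deg' : B' → P} (N : PRep k P)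

open Classical in
/-- The canonical map `F(p) ⊗ N(p) → F ⊗_P N` for a free module `F`. -/
def tensorMk (p : P) : (FreeOp k P B deg).M p →ₗ[k] N.M p →ₗ[k] tensorObj B deg N :=
  liftOp fun b h => (DirectSum.lof k B (fun b => N.M (deg b)) b).comp (N.map h)

open Classical in
theorem tensorMk_basisOp {p : P} (b : B) (h : p ≤ deg b) (n : N.M p) :
    tensorMk N p (basisOp b h) n = DirectSum.lof k B (fun b => N.M (deg b)) b (N.map h n) := by
  simp [tensorMk]

open Classical in
theorem tensorMk_basisOp_self (b : B) (n : N.M (deg b)) :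
    tensorMk N (deg b) (basisOp b le_rfl) n = DirectSum.lof k B (fun b => N.M (deg b)) b n := by
  rw [tensorMk_basisOp, N.map_refl]

theorem tensorMk_map {p q : P} (h : p ≤ q) (x : (FreeOp k P B deg).M q) (n : N.M p) :
    tensorMk N p ((FreeOp k P B deg).map h x) n = tensorMk N q x (N.map h n) := by
  refine LinearMap.congr_fun (f := ((tensorMk N p).flip n).comp ((FreeOp k P B deg).map h))
    (g := (tensorMk N q).flip (N.map h n)) (freeOp_ext fun b hb => ?_) x
  simp [tensorMk_basisOp, N.map_trans]

theorem tensorObj_ext {V : Type} [AddCommGroup V] [Module k V]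
    {f g : tensorObj B deg N →ₗ[k] V}
    (h : ∀ b n, f (tensorMk N (deg b) (basisOp b le_rfl) n) =
      g (tensorMk N (deg b) (basisOp b le_rfl) n)) : f = g := by
  classical
  refine DirectSum.linearMap_ext k fun b => LinearMap.ext fun n => ?_
  simpa [tensorMk_basisOp_self] using h b n

theorem tensorMap_gen (φ : RepOpHom (FreeOp k P B deg) (FreeOp k P B' deg')) (b : B)
    (n : N.M (deg b)) : tensorMap φ N (tensorMk N (deg b) (basisOp b le_rfl) n) =
      tensorMk N (deg b) (φ.f (deg b) (basisOp b le_rfl)) n := by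
  classical
  rw [tensorMk_basisOp_self]
  unfold tensorMap
  have : (fun a b => Classical.propDecidable (a = b)) = Classical.decEq B :=
    Subsingleton.elim _ _
  rw [this, DirectSum.toModule_lof]
  have : (fun a b => Classical.propDecidable (a = b)) = Classical.decEq B' :=
    Subsingleton.elim _ _
  unfold tensorMk liftOp
  rw [this]
  erw [Finsupp.lift_apply]
  rfl

theorem tensorMap_tensorMk (φ : RepOpHom (FreeOp k P B deg) (FreeOp k P B' deg')) {p : P}
    (x : (FreeOp k P B deg).M p) (n : N.M p) :
    tensorMap φ N (tensorMk N p x n) = tensorMk N p (φ.f p x) n := by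
  refine LinearMap.congr_fun (f := (tensorMap φ N).comp ((tensorMk N p).flip n))
    (g := ((tensorMk N p).flip n).comp (φ.f p)) (freeOp_ext fun b hb => ?_) x
  simp only [LinearMap.comp_apply, LinearMap.flip_apply]
  rw [φ.apply_basisOp, tensorMk_map, ← tensorMap_gen, ← tensorMk_map, map_basisOp]

end Tensor

section Comparison

variable {k : Type} [CommRing k] {P : Type} [PartialOrder P] {A : PRepOp k P}

/-- The cycles of a free resolution, augmented in degree zero. -/
def FreeRes.IsCycle (R : FreeRes k P A) :
    ∀ (t : ℕ) {p : P}, (FreeOp k P (R.B t) (R.deg t)).M p → Prop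
  | 0, p, x => R.aug.f p x = 0
  | t + 1, p, x => (R.d t).f p x = 0

theorem FreeRes.isCycle_d (R : FreeRes k P A) (t : ℕ) {p : P}
    (x : (FreeOp k P (R.B (t + 1)) (R.deg (t + 1))).M p) : R.IsCycle t ((R.d t).f p x) := by
  cases t with
  | zero => exact R.aug_d p x
  | succ t => exact R.dd t p x

theorem FreeRes.IsCycle.exists_d {R : FreeRes k P A} {t : ℕ} {p : P}
    {x : (FreeOp k P (R.B t) (R.deg t)).M p} (h : R.IsCycle t x) : ∃ y, (R.d t).f p y = x := by
  cases t with
  | zero => exact R.exact_aug p x h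
  | succ t => exact R.exact_d t p x h

/-- A chain map between free resolutions of `A` over the identity of `A`. -/
structure FreeRes.Map (R R' : FreeRes k P A) where
  f : ∀ t, RepOpHom (FreeOp k P (R.B t) (R.deg t)) (FreeOp k P (R'.B t) (R'.deg t))
  aug_comm : ∀ p x, R'.aug.f p ((f 0).f p x) = R.aug.f p x
  comm : ∀ t p x, (R'.d t).f p ((f (t + 1)).f p x) = (f t).f p ((R.d t).f p x)

/-- The comparison theorem: existence of a chain map. -/
theorem FreeRes.nonempty_map (R R' : FreeRes k P A) : Nonempty (R.Map R') := by
  let S (t : ℕ) := {φ : RepOpHom (FreeOp k P (R.B t) (R.deg t)) (FreeOp k P (R'.B t) (R'.deg t)) //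
    ∀ p x, R.IsCycle t x → R'.IsCycle t (φ.f p x)}
  have step (t : ℕ) (φ : S t) : ∃ ψ : S (t + 1), ∀ p x,
      (R'.d t).f p (ψ.1.f p x) = φ.1.f p ((R.d t).f p x) := by
    obtain ⟨θ, hθ⟩ := exists_lift (φ.1.comp (R.d t)) (R'.d t)
      fun p x => (φ.2 p _ (R.isCycle_d t x)).exists_d
    refine ⟨⟨θ, fun p x hx => ?_⟩, hθ⟩
    change (R'.d t).f p (θ.f p x) = 0
    rw [hθ]
    change φ.1.f p ((R.d t).f p x) = 0
    rw [show (R.d t).f p x = 0 from hx, map_zero]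
  obtain ⟨θ, hθ⟩ := exists_lift R.aug R'.aug fun p x => R'.aug_surj p _
  choose next hnext using step
  let φ : ∀ t, S t := fun t => Nat.rec
    ⟨θ, fun p x hx => (hθ p x).trans hx⟩ (fun t => next t) t
  exact ⟨⟨fun t => (φ t).1, hθ, fun t => hnext t (φ t)⟩⟩

/-- The comparison theorem: two chain maps are homotopic. -/
theorem FreeRes.Map.exists_homotopy {R R' : FreeRes k P A} (f g : R.Map R') :
    ∃ s : ∀ t, RepOpHom (FreeOp k P (R.B t) (R.deg t))
        (FreeOp k P (R'.B (t + 1)) (R'.deg (t + 1))),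
      (∀ p x, (R'.d 0).f p ((s 0).f p x) = (f.f 0).f p x - (g.f 0).f p x) ∧
      ∀ t p x, (R'.d (t + 1)).f p ((s (t + 1)).f p x) =
        (f.f (t + 1)).f p x - (g.f (t + 1)).f p x - (s t).f p ((R.d t).f p x) := by
  let S (t : ℕ) := {s : RepOpHom (FreeOp k P (R.B t) (R.deg t))
        (FreeOp k P (R'.B (t + 1)) (R'.deg (t + 1))) //
    ∀ p x, R.IsCycle t x → (R'.d t).f p (s.f p x) = (f.f t).f p x - (g.f t).f p x}
  have step (t : ℕ) (s : S t) : ∃ s' : S (t + 1), ∀ p x,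
      (R'.d (t + 1)).f p (s'.1.f p x) =
        (f.f (t + 1)).f p x - (g.f (t + 1)).f p x - s.1.f p ((R.d t).f p x) := by
    obtain ⟨θ, hθ⟩ := exists_lift (((f.f (t + 1)).sub (g.f (t + 1))).sub (s.1.comp (R.d t)))
      (R'.d (t + 1)) fun p x => by
        refine R'.exact_d t p _ ?_
        change (R'.d t).f p ((f.f (t + 1)).f p x - (g.f (t + 1)).f p x
          - s.1.f p ((R.d t).f p x)) = 0
        rw [map_sub, map_sub, f.comm, g.comm, s.2 p _ (R.isCycle_d t x), sub_self]
    refine ⟨⟨θ, fun p x hx => ?_⟩, hθ⟩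
    rw [hθ]
    change (f.f (t + 1)).f p x - (g.f (t + 1)).f p x - s.1.f p ((R.d t).f p x) = _
    rw [show (R.d t).f p x = 0 from hx, map_zero, sub_zero]
  obtain ⟨θ, hθ⟩ := exists_lift ((f.f 0).sub (g.f 0)) (R'.d 0) fun p x => by
    refine R'.exact_aug p _ ?_
    change R'.aug.f p ((f.f 0).f p x - (g.f 0).f p x) = 0
    rw [map_sub, f.aug_comm, g.aug_comm, sub_self]
  choose next hnext using step
  let s : ∀ t, S t := fun t => Nat.rec ⟨θ, fun p x _ => hθ p x⟩ (fun t => next t) t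
  exact ⟨fun t => (s t).1, hθ, fun t => hnext t (s t)⟩

/-- Linear maps that are mutually inverse modulo submodules induce an equivalence of quotients. -/
def quotEquivOfInverse {V W : Type} [AddCommGroup V] [Module k V] [AddCommGroup W] [Module k W]
    (L : Submodule k V) (L' : Submodule k W) (f : V →ₗ[k] W) (g : W →ₗ[k] V)
    (hf : ∀ x ∈ L, f x ∈ L') (hg : ∀ x ∈ L', g x ∈ L)
    (hgf : ∀ x, g (f x) - x ∈ L) (hfg : ∀ x, f (g x) - x ∈ L') : (V ⧸ L) ≃ₗ[k] (W ⧸ L') :=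
  LinearEquiv.ofLinearMap (L.mapQ L' f hf) (L'.mapQ L g hg)
    (Submodule.linearMap_qext _ <| LinearMap.ext fun x =>
      (Submodule.Quotient.eq L').mpr (hfg x))
    (Submodule.linearMap_qext _ <| LinearMap.ext fun x =>
      (Submodule.Quotient.eq L).mpr (hgf x))

variable (N : PRep k P)

theorem FreeRes.Map.tensorMap_comm {R R' : FreeRes k P A} (f : R.Map R') (t : ℕ)
    (x : tensorObj (R.B (t + 1)) (R.deg (t + 1)) N) :
    tensorMap (R'.d t) N (tensorMap (f.f (t + 1)) N x) =
      tensorMap (f.f t) N (tensorMap (R.d t) N x) := by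
  refine LinearMap.congr_fun (f := (tensorMap (R'.d t) N).comp (tensorMap (f.f (t + 1)) N))
    (g := (tensorMap (f.f t) N).comp (tensorMap (R.d t) N)) (tensorObj_ext N fun b n => ?_) x
  simp [tensorMap_tensorMk, f.comm]

theorem FreeRes.Map.comp_sub_mem_range {R R' : FreeRes k P A} (f : R.Map R') (g : R'.Map R)
    (x : tensorObj (R.B 0) (R.deg 0) N) :
    tensorMap (g.f 0) N (tensorMap (f.f 0) N x) - x ∈ LinearMap.range (tensorMap (R.d 0) N) := by
  obtain ⟨s, hs, -⟩ := FreeRes.Map.exists_homotopy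
    ⟨fun t => (g.f t).comp (f.f t), fun p x => (g.aug_comm p _).trans (f.aug_comm p x),
      fun t p x => by simp [RepOpHom.comp, f.comm, g.comm]⟩
    (⟨fun t => RepOpHom.id _, fun p x => rfl, fun t p x => rfl⟩ : R.Map R)
  refine ⟨tensorMap (s 0) N x, LinearMap.congr_fun
    (f := (tensorMap (R.d 0) N).comp (tensorMap (s 0) N))
    (g := (tensorMap (g.f 0) N).comp (tensorMap (f.f 0) N) - LinearMap.id)
    (tensorObj_ext N fun b n => ?_) x⟩
  simp [tensorMap_tensorMk, hs, RepOpHom.comp, RepOpHom.id]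

theorem FreeRes.Map.comp_sub_mem_range_succ {R R' : FreeRes k P A} (f : R.Map R') (g : R'.Map R)
    (t : ℕ) (x : tensorObj (R.B (t + 1)) (R.deg (t + 1)) N) (hx : tensorMap (R.d t) N x = 0) :
    tensorMap (g.f (t + 1)) N (tensorMap (f.f (t + 1)) N x) - x ∈
      LinearMap.range (tensorMap (R.d (t + 1)) N) := by
  obtain ⟨s, -, hs⟩ := FreeRes.Map.exists_homotopy
    ⟨fun t => (g.f t).comp (f.f t), fun p x => (g.aug_comm p _).trans (f.aug_comm p x),
      fun t p x => by simp [RepOpHom.comp, f.comm, g.comm]⟩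
    (⟨fun t => RepOpHom.id _, fun p x => rfl, fun t p x => rfl⟩ : R.Map R)
  have key := LinearMap.congr_fun
    (f := (tensorMap (R.d (t + 1)) N).comp (tensorMap (s (t + 1)) N))
    (g := (tensorMap (g.f (t + 1)) N).comp (tensorMap (f.f (t + 1)) N) - LinearMap.id
      - (tensorMap (s t) N).comp (tensorMap (R.d t) N))
    (tensorObj_ext N fun b n => by
      simp [tensorMap_tensorMk, hs, RepOpHom.comp, RepOpHom.id]) x
  refine ⟨tensorMap (s (t + 1)) N x, ?_⟩
  simpa [hx] using key

/-- `Tor` does not depend on the free resolution. -/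
theorem nonempty_tor_equiv (R R' : FreeRes k P A) (i : ℕ) :
    Nonempty (Tor R N i ≃ₗ[k] Tor R' N i) := by
  obtain ⟨f⟩ := R.nonempty_map R'
  obtain ⟨g⟩ := R'.nonempty_map R
  cases i with
  | zero =>
    refine ⟨quotEquivOfInverse _ _ (tensorMap (f.f 0) N) (tensorMap (g.f 0) N) ?_ ?_
      (f.comp_sub_mem_range N g) (g.comp_sub_mem_range N f)⟩
    · rintro _ ⟨y, rfl⟩
      exact ⟨_, f.tensorMap_comm N 0 y⟩
    · rintro _ ⟨y, rfl⟩
      exact ⟨_, g.tensorMap_comm N 0 y⟩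
  | succ i =>
    refine ⟨quotEquivOfInverse _ _
      ((tensorMap (f.f (i + 1)) N).restrict (p := LinearMap.ker (tensorMap (R.d i) N))
        (q := LinearMap.ker (tensorMap (R'.d i) N)) fun x hx => ?_)
      ((tensorMap (g.f (i + 1)) N).restrict fun x hx => ?_) ?_ ?_
      (fun x => f.comp_sub_mem_range_succ N g i x.1 x.2)
      (fun x => g.comp_sub_mem_range_succ N f i x.1 x.2)⟩
    · rw [LinearMap.mem_ker] at hx ⊢
      rw [f.tensorMap_comm, hx, map_zero]
    · rw [LinearMap.mem_ker] at hx ⊢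
      rw [g.tensorMap_comm, hx, map_zero]
    · rintro ⟨_, _⟩ ⟨y, rfl⟩
      exact ⟨_, f.tensorMap_comm N (i + 1) y⟩
    · rintro ⟨_, _⟩ ⟨y, rfl⟩
      exact ⟨_, g.tensorMap_comm N (i + 1) y⟩

end Comparison
end PosetRep

namespace PosetRep

section Bar

variable {P : Type} [PartialOrder P] [OrderTop P]

variable (P) in
/-- Strictly increasing chains in `P` ending at the top element. -/
def BarIdx (t : ℕ) : Type :=
  {c : Fin (t + 1) → P // StrictMono c ∧ c (Fin.last t) = ⊤}

/-- The bottom element of a chain. -/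
def barDeg (t : ℕ) (c : BarIdx P t) : P := c.1 0

/-- Deletion of an element other than the top from a chain. -/
def barFace {t : ℕ} (r : Fin (t + 1)) (c : BarIdx P (t + 1)) : BarIdx P t :=
  ⟨c.1 ∘ r.castSucc.succAbove, c.2.1.comp (Fin.strictMono_succAbove _), by
    rw [Function.comp_apply, Fin.succAbove_ne_last_last (Fin.castSucc_lt_last r).ne, c.2.2]⟩

/-- Extension of a chain by a new bottom element. -/
def barCons {t : ℕ} (p : P) (c : BarIdx P t) (h : p < barDeg t c) : BarIdx P (t + 1) :=
  ⟨Fin.cons p c.1, Fin.strictMono_cons.2 ⟨by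
    intro j
    exact h.trans_le (c.2.1.monotone (Fin.zero_le _)), c.2.1⟩, c.2.2⟩

theorem barDeg_le_barFace {t : ℕ} (r : Fin (t + 1)) (c : BarIdx P (t + 1)) :
    barDeg (t + 1) c ≤ barDeg t (barFace r c) :=
  c.2.1.monotone (Fin.zero_le _)

theorem barDeg_lt_barFace_zero {t : ℕ} (c : BarIdx P (t + 1)) :
    barDeg (t + 1) c < barDeg t (barFace 0 c) :=
  c.2.1 (Fin.succ_pos (0 : Fin (t + 1)))

theorem barDeg_barFace_succ {t : ℕ} (r : Fin t) (c : BarIdx P (t + 1)) :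
    barDeg t (barFace r.succ c) = barDeg (t + 1) c := by
  cases t with
  | zero => exact r.elim0
  | succ t =>
    unfold barFace barDeg
    simp

theorem barDeg_barCons {t : ℕ} (p : P) (c : BarIdx P t) (h : p < barDeg t c) :
    barDeg (t + 1) (barCons p c h) = p := rfl

theorem barFace_zero_barCons {t : ℕ} (p : P) (c : BarIdx P t) (h : p < barDeg t c) :
    barFace 0 (barCons p c h) = c := rfl

theorem barFace_succ_barCons {t : ℕ} (p : P) (c : BarIdx P (t + 1))
    (h : p < barDeg (t + 1) c) (r : Fin (t + 1)) :
    barFace r.succ (barCons p c h) =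
      barCons p (barFace r c) (h.trans_le (barDeg_le_barFace r c)) := by
  refine Subtype.ext (funext fun a => ?_)
  unfold barFace barCons
  induction a using Fin.cases <;> simp

theorem barCons_barFace_zero {t : ℕ} (c : BarIdx P (t + 1)) :
    barCons (barDeg (t + 1) c) (barFace 0 c) (barDeg_lt_barFace_zero c) = c :=
  Subtype.ext (Fin.cons_self_tail c.1)

theorem barDeg_zero (c : BarIdx P 0) : barDeg 0 c = ⊤ := c.2.2

theorem barDeg_succ_lt_top {t : ℕ} (c : BarIdx P (t + 1)) : barDeg (t + 1) c < ⊤ :=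
  (barDeg_lt_barFace_zero c).trans_le le_top

variable (P) in
/-- The chain consisting of the top element only. -/
def barTop : BarIdx P 0 := ⟨fun _ => ⊤, Subsingleton.strictMono (α := Fin 1) _, rfl⟩

theorem eq_barTop (c : BarIdx P 0) : c = barTop P :=
  Subtype.ext (funext fun a => by rw [Subsingleton.elim (α := Fin 1) a (Fin.last 0), c.2.2]; rfl)

variable (k : Type) [CommRing k]

variable (P) in
/-- The terms of the bar resolution. -/
abbrev barObj (t : ℕ) : PRepOp k P := FreeOp k P (BarIdx P t) (barDeg t)

variable (P) in
/-- The differential of the bar resolution. -/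
def barD (t : ℕ) : RepOpHom (barObj P k (t + 1)) (barObj P k t) :=
  homOfGen _ fun c => ∑ r : Fin (t + 1), (-1 : k) ^ (r : ℕ) •
    basisOp (barFace r c) (barDeg_le_barFace r c)

theorem barD_basisOp {t : ℕ} {p : P} (c : BarIdx P (t + 1)) (h : p ≤ barDeg (t + 1) c) :
    (barD P k t).f p (basisOp c h) = ∑ r : Fin (t + 1), (-1 : k) ^ (r : ℕ) •
      basisOp (barFace r c) (h.trans (barDeg_le_barFace r c)) := by
  simp [barD]

open Classical in
/-- The contracting homotopy of the bar resolution. -/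
def barH (t : ℕ) (p : P) : (barObj P k t).M p →ₗ[k] (barObj P k (t + 1)).M p :=
  liftOp fun c _ => if h : p < barDeg t c then basisOp (barCons p c h) (barDeg_barCons p c h).ge else 0

theorem barH_of_lt {t : ℕ} {p : P} (c : BarIdx P t) (h : p < barDeg t c) (h' : p ≤ barDeg t c) :
    barH k t p (basisOp c h') = basisOp (barCons p c h) (barDeg_barCons p c h).ge := by
  simp [barH, h]

theorem barH_of_eq {t : ℕ} {p : P} (c : BarIdx P t) (h : p = barDeg t c) :
    barH k t p (basisOp c h.le) = 0 := by
  simp [barH, h]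

theorem barD_barH_zero {p : P} (hp : p < ⊤) (x : (barObj P k 0).M p) :
    (barD P k 0).f p (barH k 0 p x) = x := by
  refine LinearMap.congr_fun (f := ((barD P k 0).f p).comp (barH k 0 p)) (g := LinearMap.id)
    (freeOp_ext fun c hc => ?_) x
  rw [LinearMap.comp_apply, barH_of_lt k c (hp.trans_eq (barDeg_zero c).symm), barD_basisOp]
  simp [barFace_zero_barCons]

theorem barD_barH_succ (t : ℕ) {p : P} (x : (barObj P k (t + 1)).M p) :
    (barD P k (t + 1)).f p (barH k (t + 1) p x) = x - barH k t p ((barD P k t).f p x) := by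
  refine LinearMap.congr_fun (f := ((barD P k (t + 1)).f p).comp (barH k (t + 1) p))
    (g := LinearMap.id - (barH k t p).comp ((barD P k t).f p)) (freeOp_ext fun c hc => ?_) x
  simp only [LinearMap.comp_apply, LinearMap.sub_apply, LinearMap.id_apply]
  rw [barD_basisOp, map_sum]
  simp only [map_smul]
  rcases hc.lt_or_eq with h | h
  · rw [barH_of_lt k c h, barD_basisOp, Fin.sum_univ_succ, sub_eq_add_neg,
      ← Finset.sum_neg_distrib]
    congr 1
    · simp [barFace_zero_barCons]
    · refine Finset.sum_congr rfl fun r _ => ?_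
      rw [barH_of_lt k _ (h.trans_le (barDeg_le_barFace r c))]
      simp [barFace_succ_barCons, pow_succ]
  · subst h
    rw [barH_of_eq k c rfl, map_zero, Fin.sum_univ_succ,
      barH_of_lt k _ (barDeg_lt_barFace_zero c), Finset.sum_eq_zero]
    · simp [barCons_barFace_zero]
    · intro r _
      rw [barH_of_eq k _ (barDeg_barFace_succ r c).symm, smul_zero]

theorem barD_barD (t : ℕ) (p : P) (x : (barObj P k (t + 2)).M p) :
    (barD P k t).f p ((barD P k (t + 1)).f p x) = 0 := by
  refine LinearMap.congr_fun (f := ((barD P k t).f p).comp ((barD P k (t + 1)).f p)) (g := 0)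
    (freeOp_ext fun c hc => ?_) x
  rw [LinearMap.comp_apply, LinearMap.zero_apply, (barD P k (t + 1)).apply_basisOp,
    (barD P k t).comm]
  have hlt := barDeg_lt_barFace_zero c
  have hc' : basisOp (k := k) c le_rfl = barH k (t + 1) (barDeg (t + 2) c)
      (basisOp (barFace 0 c) hlt.le) := by
    rw [barH_of_lt k _ hlt]
    congr 1
    exact (barCons_barFace_zero c).symm
  rw [hc', barD_barH_succ, map_sub]
  cases t with
  | zero => rw [barD_barH_zero k (barDeg_succ_lt_top c), sub_self, map_zero]
  | succ t => rw [barD_barH_succ, barD_barD t, map_zero, sub_zero, sub_self, map_zero]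

variable (P) in
/-- The augmentation of the bar resolution. -/
def barAug : RepOpHom (barObj P k 0) (SimpleOp k P ⊤ k) :=
  homOfGen _ fun c => ⟨1, fun h => (h (barDeg_zero c)).elim⟩

theorem simpleOp_eq_zero {p : P} (hp : p ≠ ⊤) (x : (SimpleOp k P ⊤ k).M p) : x = 0 :=
  Subtype.ext (x.2 hp)

theorem barObj_succ_top (t : ℕ) (x : (barObj P k (t + 1)).M ⊤) : x = 0 :=
  LinearMap.congr_fun (f := LinearMap.id) (g := 0) (freeOp_ext fun c hc =>
    ((barDeg_succ_lt_top c).not_ge hc).elim) x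

theorem barAug_basisOp (c : BarIdx P 0) :
    (barAug P k).f ⊤ (basisOp c (barDeg_zero c).ge) = ⟨1, fun h => (h rfl).elim⟩ := by
  refine (homOfGen_basisOp _ _ _ _).trans (Subtype.ext ?_)
  exact if_pos (barDeg_zero c).symm

variable (P) in
/-- The section of the augmentation of the bar resolution at the top element. -/
def barSec : (SimpleOp k P ⊤ k).M ⊤ →ₗ[k] (barObj P k 0).M ⊤ :=
  (LinearMap.toSpanSingleton k ((barObj P k 0).M ⊤)
    (basisOp (barTop P) (barDeg_zero _).ge)).comp (diagSubmodule k P ⊤ ⊤ k).subtype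

theorem barSec_barAug (x : (barObj P k 0).M ⊤) : barSec P k ((barAug P k).f ⊤ x) = x := by
  refine LinearMap.congr_fun (f := (barSec P k).comp ((barAug P k).f ⊤)) (g := LinearMap.id)
    (freeOp_ext fun c hc => ?_) x
  obtain rfl := eq_barTop c
  rw [LinearMap.comp_apply, barAug_basisOp]
  exact one_smul k _

theorem barAug_barSec (v : (SimpleOp k P ⊤ k).M ⊤) : (barAug P k).f ⊤ (barSec P k v) = v := by
  have h : barSec P k v = (diagSubmodule k P ⊤ ⊤ k).subtype v •
    basisOp (deg := barDeg 0) (barTop P) (barDeg_zero _).ge := rfl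
  rw [h, map_smul, barAug_basisOp]
  exact Subtype.ext (mul_one _)

variable (P) in
/-- The bar resolution of the simple representation at the top element. -/
def barRes : FreeRes k P (SimpleOp k P ⊤ k) where
  B := BarIdx P
  deg := barDeg
  d := barD P k
  aug := barAug P k
  aug_surj p v := by
    by_cases hp : p = ⊤
    · subst hp
      exact ⟨_, barAug_barSec k v⟩
    · exact ⟨0, by rw [map_zero, simpleOp_eq_zero k hp v]⟩
  aug_d p x := by
    by_cases hp : p = ⊤
    · subst hp
      rw [barObj_succ_top k 0 x, map_zero, map_zero]
    · exact simpleOp_eq_zero k hp _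
  dd := barD_barD k
  exact_aug p x hx := by
    by_cases hp : p = ⊤
    · subst hp
      refine ⟨0, ?_⟩
      rw [map_zero, ← barSec_barAug k x, hx, map_zero]
    · exact ⟨_, barD_barH_zero k (lt_top_iff_ne_top.2 hp) x⟩
  exact_d t p x hx := ⟨barH k (t + 1) p x, by rw [barD_barH_succ, hx, map_zero, sub_zero]⟩

end Bar

end PosetRep

namespace PosetRep

section SimpleTensor

variable {k : Type} [CommRing k] {P : Type} [PartialOrder P] {q : P}

/-- The canonical generator of the simple representation at `q`. -/
def simpleUnit {p : P} (h : p = q) : (Simple k P q k).M p := ⟨1, fun h' => (h' h).elim⟩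

theorem simple_eq_zero {p : P} (h : p ≠ q) (n : (Simple k P q k).M p) : n = 0 :=
  Subtype.ext (n.2 h)

theorem simple_eq_smul {p : P} (h : p = q) (n : (Simple k P q k).M p) :
    n = (diagSubmodule k P p q k).subtype n • simpleUnit h :=
  Subtype.ext (mul_one _).symm

theorem simple_map_of_lt {p p' : P} (h : p < p') (n : (Simple k P q k).M p) :
    (Simple k P q k).map h.le n = 0 :=
  Subtype.ext (if_neg h.ne)

theorem simple_map_simpleUnit {p p' : P} (h : p ≤ p') (hp : p = q) (hp' : p' = q) :
    (Simple k P q k).map h (simpleUnit hp) = simpleUnit hp' :=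
  Subtype.ext (if_pos (hp.trans hp'.symm))

variable {B : Type} {deg : B → P}

/-- The generator of `F ⊗ S_q` given by a basis element of degree `q`. -/
def tensorUnit (b : B) (h : deg b = q) : tensorObj B deg (Simple k P q k) :=
  tensorMk _ (deg b) (basisOp b le_rfl) (simpleUnit h)

theorem tensorSimple_ext {V : Type} [AddCommGroup V] [Module k V]
    {f g : tensorObj B deg (Simple k P q k) →ₗ[k] V}
    (h : ∀ b hb, f (tensorUnit b hb) = g (tensorUnit b hb)) : f = g := by
  refine tensorObj_ext _ fun b n => ?_
  by_cases hb : deg b = q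
  · rw [simple_eq_smul hb n, map_smul, map_smul, map_smul]
    congr 1
    exact h b hb
  · rw [simple_eq_zero hb n, map_zero, map_zero, map_zero]

open Classical in
/-- The forward map of `tensorSimpleEquiv`. -/
def tensorSimpleToFun (B : Type) (deg : B → P) :
    tensorObj B deg (Simple k P q k) →ₗ[k] ({b : B // deg b = q} →₀ k) :=
  DirectSum.toModule k B _ fun b =>
    if h : deg b = q then
      (Finsupp.lsingle ⟨b, h⟩).comp (diagSubmodule k P (deg b) q k).subtype
    else 0

theorem tensorSimpleToFun_tensorUnit (b : B) (h : deg b = q) :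
    tensorSimpleToFun B deg (tensorUnit (k := k) b h) = Finsupp.single ⟨b, h⟩ 1 := by
  classical
  unfold tensorUnit tensorSimpleToFun
  rw [tensorMk_basisOp_self]
  rw [DirectSum.toModule_lof, dif_pos h]
  rfl

/-- `F ⊗ S_q` is free on the basis elements of `F` of degree `q`. -/
def tensorSimpleEquiv (B : Type) (deg : B → P) :
    tensorObj B deg (Simple k P q k) ≃ₗ[k] ({b : B // deg b = q} →₀ k) :=
  LinearEquiv.ofLinearMap (tensorSimpleToFun B deg)
    (Finsupp.lift _ k _ fun b => tensorUnit b.1 b.2)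
    (Finsupp.lhom_ext' fun b => LinearMap.ext_ring <| by
      simp [tensorSimpleToFun_tensorUnit])
    (tensorSimple_ext fun b h => by
      simp [tensorSimpleToFun_tensorUnit])

@[simp]
theorem tensorSimpleEquiv_tensorUnit (b : B) (h : deg b = q) :
    tensorSimpleEquiv B deg (tensorUnit (k := k) b h) = Finsupp.single ⟨b, h⟩ 1 :=
  tensorSimpleToFun_tensorUnit b h

end SimpleTensor

section Interval

variable (k : Type) [CommRing k] {P : Type} [PartialOrder P] [OrderTop P] (q : P)

theorem tensorMap_barD_tensorUnit (t : ℕ) (c : BarIdx P (t + 1)) (h : barDeg (t + 1) c = q) :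
    tensorMap (barD P k t) (Simple k P q k) (tensorUnit c h) =
      ∑ r : Fin t, (-1 : k) ^ (r + 1 : ℕ) •
        tensorUnit (barFace r.succ c) ((barDeg_barFace_succ r c).trans h) := by
  have key (r : Fin (t + 1)) : tensorMk (Simple k P q k) (barDeg (t + 1) c)
      (basisOp (barFace r c) (barDeg_le_barFace r c)) (simpleUnit h) =
      tensorMk (Simple k P q k) (barDeg t (barFace r c)) (basisOp (barFace r c) le_rfl)
        ((Simple k P q k).map (barDeg_le_barFace r c) (simpleUnit h)) := by
    rw [← tensorMk_map, map_basisOp]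
  unfold tensorUnit
  rw [tensorMap_gen, barD_basisOp, map_sum, LinearMap.sum_apply, Fin.sum_univ_succ]
  simp only [map_smul, LinearMap.smul_apply, key]
  rw [simple_map_of_lt (barDeg_lt_barFace_zero c), map_zero, smul_zero, zero_add]
  refine Finset.sum_congr rfl fun r _ => ?_
  rw [simple_map_simpleUnit _ h ((barDeg_barFace_succ r c).trans h), Fin.val_succ]

variable {q} in
/-- The chain in the open interval obtained by deleting both ends of a chain. -/
def intervalOfBar {j : ℕ} (c : BarIdx P (j + 2)) (h : barDeg (j + 2) c = q) : IntervalIdx P q j :=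
  ⟨fun a => c.1 a.castSucc.succ,
    c.2.1.comp ((Fin.strictMono_succ).comp Fin.strictMono_castSucc), fun a =>
      ⟨h.symm.trans_lt (c.2.1 (Fin.succ_pos _)),
        (c.2.1 (Fin.succ_lt_succ_iff.2 (Fin.castSucc_lt_last a))).trans_eq c.2.2⟩⟩

variable {q} in
/-- The chain obtained from a chain in the open interval by adding the top element. -/
def barSnoc {j : ℕ} (d : IntervalIdx P q j) : BarIdx P (j + 1) :=
  ⟨Fin.snoc (α := fun _ => P) d.1 ⊤, by
    refine Fin.strictMono_iff_lt_succ.2 fun a => ?_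
    induction a using Fin.lastCases with
    | last => simpa [Fin.succ_last] using (d.2.2 (Fin.last j)).2
    | cast a =>
      rw [Fin.succ_castSucc, Fin.snoc_castSucc, Fin.snoc_castSucc]
      exact d.2.1 Fin.castSucc_lt_succ, Fin.snoc_last (α := fun _ => P) _ _⟩

theorem lt_barDeg_barSnoc {j : ℕ} (d : IntervalIdx P q j) : q < barDeg (j + 1) (barSnoc d) :=
  (d.2.2 0).1.trans_eq (Fin.snoc_apply_zero (α := fun _ => P) ⊤ _).symm

/-- Chains from `q` to the top element correspond to chains in the open interval. -/
def barIntervalEquiv (j : ℕ) :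
    {c : BarIdx P (j + 2) // barDeg (j + 2) c = q} ≃ IntervalIdx P q j where
  toFun c := intervalOfBar c.1 c.2
  invFun d := ⟨barCons q (barSnoc d) (lt_barDeg_barSnoc q d), rfl⟩
  left_inv := by
    rintro ⟨c, rfl⟩
    refine Subtype.ext (Eq.trans ?_ (barCons_barFace_zero c))
    dsimp only
    congr 1
    refine Subtype.ext (funext fun a => ?_)
    induction a using Fin.lastCases with
    | last => exact (Fin.snoc_last (α := fun _ => P) _ _).trans c.2.2.symm
    | cast a => exact Fin.snoc_castSucc (α := fun _ => P) _ _ _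
  right_inv d := Subtype.ext (funext fun a => Fin.snoc_castSucc (α := fun _ => P) _ _ _)

theorem intervalOfBar_barFace {j : ℕ} (r : Fin (j + 2)) (c : BarIdx P (j + 3))
    (h : barDeg (j + 3) c = q) :
    intervalOfBar (barFace r.succ c) ((barDeg_barFace_succ r c).trans h) =
      intFace r (intervalOfBar c h) := by
  refine Subtype.ext (funext fun a => ?_)
  change c.1 (r.succ.castSucc.succAbove a.castSucc.succ) = c.1 (r.succAbove a).castSucc.succ
  rw [← Fin.succ_castSucc, Fin.succ_succAbove_succ, Fin.castSucc_succAbove_castSucc]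

variable {q} in
/-- The basis element of the simplicial chains given by a simplex. -/
def chainSingle {j : ℕ} (c : IntervalIdx P q j) : chainMod k P q j := Finsupp.single c 1

/-- The bar resolution tensored with `S_q` computes the simplicial chains of the interval. -/
def barChainEquiv (j : ℕ) :
    tensorObj (BarIdx P (j + 2)) (barDeg (j + 2)) (Simple k P q k) ≃ₗ[k] chainMod k P q j :=
  (tensorSimpleEquiv _ _).trans (Finsupp.domLCongr (barIntervalEquiv q j))

theorem barChainEquiv_tensorUnit {j : ℕ} (c : BarIdx P (j + 2)) (h : barDeg (j + 2) c = q) :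
    barChainEquiv k q j (tensorUnit c h) = chainSingle k (intervalOfBar c h) := by
  refine (congrArg (Finsupp.domLCongr (R := k) (barIntervalEquiv q j))
    (tensorSimpleEquiv_tensorUnit c h)).trans ?_
  exact Finsupp.domLCongr_single _ _ _

theorem bdry_chainSingle {j : ℕ} (c : IntervalIdx P q (j + 1)) :
    bdry k P q j (chainSingle k c) =
      ∑ r : Fin (j + 2), (-1 : k) ^ (r : ℕ) • chainSingle k (intFace r c) := by
  unfold bdry chainSingle
  erw [Finsupp.lift_apply, Finsupp.sum_single_index]
  · exact one_smul _ _
  · exact zero_smul _ _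

theorem chainAug_chainSingle (c : IntervalIdx P q 0) :
    chainAug k P q (chainSingle k c) = 1 := by
  unfold chainAug chainSingle
  erw [Finsupp.lift_apply, Finsupp.sum_single_index]
  · exact one_smul _ _
  · exact zero_smul _ _

theorem barChainEquiv_tensorMap (j : ℕ)
    (x : tensorObj (BarIdx P (j + 3)) (barDeg (j + 3)) (Simple k P q k)) :
    barChainEquiv k q j (tensorMap (barD P k (j + 2)) (Simple k P q k) x) =
      -bdry k P q j (barChainEquiv k q (j + 1) x) := by
  refine LinearMap.congr_fun
    (f := (barChainEquiv k q j).toLinearMap.comp (tensorMap (barD P k (j + 2)) (Simple k P q k)))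
    (g := -(bdry k P q j).comp (barChainEquiv k q (j + 1)).toLinearMap)
    (tensorSimple_ext fun c h => ?_) x
  simp only [LinearMap.comp_apply, LinearMap.neg_apply, LinearEquiv.coe_coe]
  rw [tensorMap_barD_tensorUnit, barChainEquiv_tensorUnit, bdry_chainSingle, map_sum]
  refine Eq.trans ?_ (Finset.sum_neg_distrib _)
  refine Finset.sum_congr rfl fun r _ => ?_
  rw [map_smul, barChainEquiv_tensorUnit, intervalOfBar_barFace q r c h, pow_succ, mul_neg_one,
    neg_smul]

variable {q}

/-- There is at most one chain of length one from `q` to the top element. -/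
theorem subsingleton_barIdx_one : Subsingleton {c : BarIdx P 1 // barDeg 1 c = q} := by
  have key (c : {c : BarIdx P 1 // barDeg 1 c = q}) (h : q < barDeg 0 (barTop P)) :
      c.1 = barCons q (barTop P) h := by
    obtain ⟨c, rfl⟩ := c
    refine (barCons_barFace_zero c).symm.trans ?_
    congr 1
    exact eq_barTop _
  refine ⟨fun c c' => Subtype.ext ?_⟩
  have h : q < barDeg 0 (barTop P) := c.2.symm.trans_lt (barDeg_succ_lt_top c.1)
  rw [key c h, key c' h]

/-- The bar resolution tensored with `S_q` in degree one. -/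
def barChainEquivOne (hq : q < ⊤) :
    tensorObj (BarIdx P 1) (barDeg 1) (Simple k P q k) ≃ₗ[k] k :=
  haveI := subsingleton_barIdx_one (q := q)
  (tensorSimpleEquiv _ _).trans (Finsupp.uniqueLinearEquiv k k ⟨barCons q (barTop P) hq, rfl⟩)

theorem barChainEquivOne_tensorUnit (hq : q < ⊤) (c : BarIdx P 1) (h : barDeg 1 c = q) :
    barChainEquivOne k hq (tensorUnit c h) = 1 := by
  have := subsingleton_barIdx_one (q := q)
  refine (congrArg (Finsupp.uniqueLinearEquiv k k ⟨barCons q (barTop P) hq, rfl⟩)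
    (tensorSimpleEquiv_tensorUnit c h)).trans ?_
  rw [Subsingleton.elim (⟨c, h⟩ : {c : BarIdx P 1 // barDeg 1 c = q})
    ⟨barCons q (barTop P) hq, rfl⟩]
  simp

theorem barChainEquivOne_tensorMap (hq : q < ⊤)
    (x : tensorObj (BarIdx P 2) (barDeg 2) (Simple k P q k)) :
    barChainEquivOne k hq (tensorMap (barD P k 1) (Simple k P q k) x) =
      -chainAug k P q (barChainEquiv k q 0 x) := by
  refine LinearMap.congr_fun
    (f := (barChainEquivOne k hq).toLinearMap.comp (tensorMap (barD P k 1) (Simple k P q k)))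
    (g := -(chainAug k P q).comp (barChainEquiv k q 0).toLinearMap)
    (tensorSimple_ext fun c h => ?_) x
  simp only [LinearMap.comp_apply, LinearMap.neg_apply, LinearEquiv.coe_coe]
  rw [tensorMap_barD_tensorUnit, barChainEquiv_tensorUnit, chainAug_chainSingle]
  simp [barChainEquivOne_tensorUnit]

theorem tensorObj_barIdx_zero (hq : q < ⊤)
    (x : tensorObj (BarIdx P 0) (barDeg 0) (Simple k P q k)) : x = 0 :=
  LinearMap.congr_fun (f := LinearMap.id) (g := 0) (tensorSimple_ext fun c h =>
    (hq.ne (h.symm.trans (barDeg_zero c))).elim) x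

/-- Homology is invariant under isomorphisms commuting with the differentials up to sign. -/
theorem nonempty_homologyAt_equiv {A B C A' B' C' : Type} [AddCommGroup A] [Module k A]
    [AddCommGroup B] [Module k B] [AddCommGroup C] [Module k C] [AddCommGroup A'] [Module k A']
    [AddCommGroup B'] [Module k B'] [AddCommGroup C'] [Module k C']
    {dp : A →ₗ[k] B} {d : B →ₗ[k] C} {dp' : A' →ₗ[k] B'} {d' : B' →ₗ[k] C'}
    (eA : A ≃ₗ[k] A') (eB : B ≃ₗ[k] B') (eC : C ≃ₗ[k] C')
    (hA : ∀ x, eB (dp x) = -dp' (eA x)) (hB : ∀ x, eC (d x) = -d' (eB x)) :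
    Nonempty (homologyAt dp d ≃ₗ[k] homologyAt dp' d') := by
  refine ⟨quotEquivOfInverse _ _
    (eB.toLinearMap.restrict (p := LinearMap.ker d) (q := LinearMap.ker d') fun x hx => ?_)
    (eB.symm.toLinearMap.restrict fun x hx => ?_) ?_ ?_ (fun x => ?_) (fun x => ?_)⟩
  · have := hB x
    rw [LinearMap.mem_ker] at hx ⊢
    rw [hx, map_zero] at this
    exact neg_eq_zero.1 this.symm
  · have := hB (eB.symm x)
    rw [LinearMap.mem_ker] at hx ⊢
    rw [eB.apply_symm_apply, hx, neg_zero] at this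
    exact eC.map_eq_zero_iff.1 this
  · rintro ⟨_, _⟩ ⟨y, rfl⟩
    exact ⟨-eA y, by simp [hA]⟩
  · rintro ⟨_, _⟩ ⟨y, rfl⟩
    refine ⟨-eA.symm y, eB.injective ?_⟩
    simp [hA]
  · convert Submodule.zero_mem _
    exact Subtype.ext (by simp)
  · convert Submodule.zero_mem _
    exact Subtype.ext (by simp)

/-- The homology of the bar resolution tensored with `S_q`. -/
theorem nonempty_tor_barRes_equiv (hq : q < ⊤) (i : ℕ) :
    Nonempty (Tor (barRes P k) (Simple k P q k) i ≃ₗ[k] redH k P q i) := by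
  match i with
  | 0 =>
    have : Subsingleton (tensorObj (BarIdx P 0) (barDeg 0) (Simple k P q k)) :=
      subsingleton_of_forall_eq 0 (tensorObj_barIdx_zero k hq)
    refine ⟨(?_ : (tensorObj (BarIdx P 0) (barDeg 0) (Simple k P q k) ⧸
      LinearMap.range (tensorMap (barD P k 0) (Simple k P q k))) ≃ₗ[k] PUnit)⟩
    exact LinearEquiv.ofLinearMap 0 0 (Subsingleton.elim _ _) (Subsingleton.elim _ _)
  | 1 =>
    refine ⟨(quotEquivOfInverse _ _
      ((barChainEquivOne k hq).toLinearMap.comp (Submodule.subtype _))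
      ((barChainEquivOne k hq).symm.toLinearMap.codRestrict _ fun x =>
        tensorObj_barIdx_zero k hq _) ?_ ?_ (fun x => ?_) (fun x => ?_) :
      homologyAt (tensorMap (barD P k 1) (Simple k P q k))
        (tensorMap (barD P k 0) (Simple k P q k)) ≃ₗ[k] k ⧸ LinearMap.range (chainAug k P q))⟩
    · rintro ⟨_, _⟩ ⟨y, rfl⟩
      exact ⟨-barChainEquiv k q 0 y, by simp [barChainEquivOne_tensorMap]⟩
    · rintro _ ⟨y, rfl⟩
      refine ⟨-(barChainEquiv k q 0).symm y, (barChainEquivOne k hq).injective ?_⟩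
      refine (barChainEquivOne_tensorMap k hq _).trans ?_
      rw [map_neg, map_neg, neg_neg, LinearEquiv.apply_symm_apply]
      exact ((barChainEquivOne k hq).apply_symm_apply _).symm
    · convert Submodule.zero_mem _
      exact sub_eq_zero.2 (Subtype.ext ((barChainEquivOne k hq).symm_apply_apply _))
    · convert Submodule.zero_mem _
      exact sub_eq_zero.2 ((barChainEquivOne k hq).apply_symm_apply _)
  | 2 =>
    exact nonempty_homologyAt_equiv k (barChainEquiv k q 1) (barChainEquiv k q 0)
      (barChainEquivOne k hq) (barChainEquiv_tensorMap k q 0) (barChainEquivOne_tensorMap k hq)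
  | j + 3 =>
    exact nonempty_homologyAt_equiv k (barChainEquiv k q (j + 2)) (barChainEquiv k q (j + 1))
      (barChainEquiv k q j) (barChainEquiv_tensorMap k q (j + 1)) (barChainEquiv_tensorMap k q j)

end Interval

end PosetRep

theorem statement_8 (k : Type) [CommRing k] (P : Type) [PartialOrder P]
    [OrderTop P] [Finite P] (q : P) (hq : q < ⊤)
    (R : FreeRes k P (SimpleOp k P ⊤ k)) (i : ℕ) :
    Nonempty ((Tor R (Simple k P q k) i) ≃ₗ[k] redH k P q i) := by
  exact ⟨(nonempty_tor_equiv (Simple k P q k) R (barRes P k) i).some.trans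
    (nonempty_tor_barRes_equiv k hq i).some⟩
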